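/- For every integer k ≥ 2, limsup_{n → ∞} (log τ_k^{(e)}(n) · log log n) / log n = (log k)/2. -/

import Mathlib

/-- `tauk k n` is the number of ordered `k`-tuples of positive integers whose
product is `n` (the multidimensional divisor function `τ_k`). -/
noncomputable def tauk (k n : ℕ) : ℕ :=
  Nat.card {d : Fin k → ℕ // (∀ i, 0 < d i) ∧ ∏ i, d i = n}

open Filter Real Topology

theorem finite_factorizations (k : ℕ) {n : ℕ} (hn : 0 < n) :
    Finite {d : Fin k → ℕ // (∀ i, 0 < d i) ∧ ∏ i, d i = n} := by
  refine Set.Finite.subset (Set.finite_Icc (0 : Fin k → ℕ) (fun _ => n)) ?_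
  rintro d ⟨-, hd⟩
  refine ⟨fun i => Nat.zero_le _, fun i => Nat.le_of_dvd hn ?_⟩
  exact hd ▸ Finset.dvd_prod_of_mem d (Finset.mem_univ i)

theorem tauk_pos {k n : ℕ} (hk : 0 < k) (hn : 0 < n) : 0 < tauk k n := by
  have := finite_factorizations k hn
  have : Nonempty {d : Fin k → ℕ // (∀ i, 0 < d i) ∧ ∏ i, d i = n} := by
    refine ⟨⟨Pi.mulSingle ⟨0, hk⟩ n, fun i => ?_, by simp⟩⟩
    by_cases h : i = ⟨0, hk⟩
    · subst h; simpa using hn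
    · simp [Pi.mulSingle_eq_of_ne h]
  exact Nat.card_pos

theorem le_tauk (k : ℕ) {n : ℕ} (hn : 2 ≤ n) : k ≤ tauk k n := by
  have := finite_factorizations k (show 0 < n by omega)
  let f : Fin k → {d : Fin k → ℕ // (∀ i, 0 < d i) ∧ ∏ i, d i = n} := fun j =>
    ⟨Pi.mulSingle j n, fun i => by
      by_cases h : i = j
      · subst h; simp; omega
      · simp [Pi.mulSingle_eq_of_ne h], by simp⟩
  have hf : Function.Injective f := fun a b hab => by
    have h := congrFun (congrArg Subtype.val hab) a
    by_contra hne
    simp [f, Pi.mulSingle_eq_of_ne hne] at h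
    omega
  simpa [tauk] using Nat.card_le_card_of_injective f hf

theorem tauk_one_le (k : ℕ) : tauk k 1 ≤ 1 := by
  have := finite_factorizations k one_pos
  refine Finite.card_le_one_iff_subsingleton.2 ⟨fun a b => Subtype.ext (funext fun i => ?_)⟩
  have h : ∀ d : {d : Fin k → ℕ // (∀ i, 0 < d i) ∧ ∏ i, d i = 1}, d.1 i = 1 := fun d =>
    Nat.dvd_one.1 ((Finset.dvd_prod_of_mem d.1 (Finset.mem_univ i)).trans d.2.2.dvd)
  rw [h a, h b]

theorem tauk_prime_mul_le (k : ℕ) {p m : ℕ} (hp : p.Prime) (hm : 0 < m) :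
    tauk k (p * m) ≤ k * tauk k m := by
  have := finite_factorizations k hm
  let f : Fin k × {d : Fin k → ℕ // (∀ i, 0 < d i) ∧ ∏ i, d i = m} →
      {d : Fin k → ℕ // (∀ i, 0 < d i) ∧ ∏ i, d i = p * m} := fun x =>
    ⟨Pi.mulSingle x.1 p * x.2.1, fun i => by
      refine Nat.mul_pos ?_ (x.2.2.1 i)
      by_cases h : i = x.1
      · subst h; simpa using hp.pos
      · simp [Pi.mulSingle_eq_of_ne h],
      by simp [Finset.prod_mul_distrib, x.2.2.2]⟩
  have hf : Function.Surjective f := by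
    rintro ⟨d, hd, hprod⟩
    obtain ⟨i, -, c, hc⟩ := (hp.prime.dvd_finsetProd_iff d).1 (hprod ▸ dvd_mul_right p m)
    have hc0 : 0 < c := Nat.pos_of_ne_zero fun h => by simpa [hc, h] using hd i
    have hdc : Pi.mulSingle i p * Function.update d i c = d := by
      ext j
      by_cases h : j = i
      · subst h; simp [hc]
      · simp [h]
    refine ⟨⟨i, Function.update d i c, fun j => ?_, ?_⟩, Subtype.ext hdc⟩
    · by_cases h : j = i
      · subst h; simpa using hc0
      · simpa [h] using hd j
    · refine Nat.eq_of_mul_eq_mul_left hp.pos ?_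
      rw [← hprod]
      conv_rhs => rw [← hdc]
      simp [Finset.prod_mul_distrib]
  have h := Nat.card_le_card_of_surjective f hf
  simpa [tauk, Nat.card_prod] using h

theorem tauk_le_pow_log (k : ℕ) {n : ℕ} (hn : 0 < n) (hk : 0 < k) :
    tauk k n ≤ k ^ Nat.log 2 n := by
  induction n using Nat.strong_induction_on with
  | _ n ih =>
    rcases Nat.eq_or_lt_of_le (show 1 ≤ n from hn) with rfl | h1
    · simpa using tauk_one_le k
    · have hp := Nat.minFac_prime h1.ne'
      obtain ⟨m, hm⟩ := Nat.minFac_dvd n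
      have hm0 : 0 < m := Nat.pos_of_ne_zero fun h => by simp [h] at hm; omega
      have h2m : m * 2 ≤ n := by nlinarith [hp.two_le]
      calc tauk k n = tauk k (n.minFac * m) := by rw [← hm]
        _ ≤ k * tauk k m := tauk_prime_mul_le k hp hm0
        _ ≤ k * k ^ Nat.log 2 m := Nat.mul_le_mul_left _ (ih m (by omega) hm0)
        _ = k ^ Nat.log 2 (m * 2) := by
          rw [Nat.log_mul_base one_lt_two hm0.ne', pow_succ']
        _ ≤ k ^ Nat.log 2 n := Nat.pow_le_pow_right hk (Nat.log_mono_right h2m)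

theorem two_mul_log_two_le (n : ℕ) : 2 * Nat.log 2 n ≤ n := by
  rcases n.eq_zero_or_pos with rfl | hn
  · simp
  · have h := Nat.pow_log_le_self 2 hn.ne'
    rcases Nat.eq_zero_or_pos (Nat.log 2 n) with h0 | h0
    · omega
    · obtain ⟨j, hj⟩ := Nat.exists_eq_succ_of_ne_zero h0.ne'
      rw [hj, pow_succ] at h
      have := Nat.lt_two_pow_self (n := j)
      omega

theorem log_tauk_le (k : ℕ) {a : ℕ} (ha : 0 < a) (hk : 0 < k) :
    log (tauk k a) ≤ Nat.log 2 a * log k := by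
  rw [← Real.log_pow]
  exact Real.log_le_log (mod_cast tauk_pos hk ha) (mod_cast tauk_le_pow_log k ha hk)

/-- The pointwise bound obtained by separating the primes below and above a threshold `y`. -/
theorem log_le_of_threshold {k : ℕ} (hk : 2 ≤ k) {F : ℕ → ℕ} (hF1 : F 1 = 1)
    (hmul : ∀ m n : ℕ, Nat.Coprime m n → F (m * n) = F m * F n)
    (hFp : ∀ p a : ℕ, p.Prime → 1 ≤ a → F (p ^ a) = tauk k a)
    {n : ℕ} (hn : n ≠ 0) {y : ℝ} (hy : 1 < y) :
    log (F n) ≤ y * (logb 2 (logb 2 n) * log k) + log k / 2 * log n / log y := by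
  have hk0 : 0 < log k := log_pos (by exact_mod_cast hk)
  have hly : 0 < log y := log_pos hy
  have hF : F n = ∏ p ∈ n.primeFactors, tauk k (n.factorization p) := by
    rw [Nat.multiplicative_factorization F hmul hF1 hn, Finsupp.prod, Nat.support_factorization]
    refine Finset.prod_congr rfl fun p hp => hFp p _ (Nat.prime_of_mem_primeFactors hp) ?_
    exact (Nat.prime_of_mem_primeFactors hp).factorization_pos_of_dvd hn
      (Nat.dvd_of_mem_primeFactors hp)
  have hpos : ∀ p ∈ n.primeFactors, 0 < n.factorization p := fun p hp =>
    (Nat.prime_of_mem_primeFactors hp).factorization_pos_of_dvd hn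
      (Nat.dvd_of_mem_primeFactors hp)
  set A : ℝ := logb 2 (logb 2 n) * log k with hA
  have hsmall : ∀ p ∈ n.primeFactors, log (tauk k (n.factorization p)) ≤ A ∧ 0 ≤ A := by
    intro p hp
    have ha := hpos p hp
    have hpp := Nat.prime_of_mem_primeFactors hp
    have h2 : 2 ^ n.factorization p ≤ n :=
      (Nat.pow_le_pow_left hpp.two_le _).trans (Nat.ordProj_le p hn)
    have h3 : (n.factorization p : ℝ) ≤ logb 2 n := by
      rw [le_logb_iff_rpow_le one_lt_two (by positivity), rpow_natCast]
      exact_mod_cast h2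
    have h4 : (Nat.log 2 (n.factorization p) : ℝ) ≤ logb 2 (n.factorization p) := by
      exact_mod_cast Real.natLog_le_logb (n.factorization p) 2
    have h5 : logb 2 (n.factorization p) ≤ logb 2 (logb 2 n) :=
      logb_le_logb_of_le one_lt_two (by exact_mod_cast ha) h3
    constructor
    · exact (log_tauk_le k ha (by omega)).trans
        (mul_le_mul_of_nonneg_right (h4.trans h5) hk0.le)
    · exact mul_nonneg ((Nat.cast_nonneg _).trans (h4.trans h5)) hk0.le
  have hterm : ∀ p ∈ n.primeFactors, log (tauk k (n.factorization p)) ≤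
      (if (p : ℝ) ≤ y then A else 0)
        + log k / 2 / log y * (n.factorization p * log p) := by
    intro p hp
    have hpp := Nat.prime_of_mem_primeFactors hp
    split_ifs with h
    · have : 0 ≤ log k / 2 / log y * (n.factorization p * log p) := by
        have := log_natCast_nonneg p
        positivity
      linarith [(hsmall p hp).1]
    · rw [zero_add]
      have h1 : (2 : ℝ) * Nat.log 2 (n.factorization p) ≤ n.factorization p := by
        exact_mod_cast two_mul_log_two_le _
      have h2 : log y ≤ log p := log_le_log (by linarith) (by linarith)
      calc log (tauk k (n.factorization p))
          ≤ Nat.log 2 (n.factorization p) * log k := log_tauk_le k (hpos p hp) (by omega)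
        _ ≤ log k / 2 * n.factorization p := by nlinarith
        _ = log k / 2 / log y * (n.factorization p * log y) := by field_simp
        _ ≤ _ := by gcongr
  have hcard : ∑ p ∈ n.primeFactors, (if (p : ℝ) ≤ y then A else 0) ≤ y * A := by
    rcases n.primeFactors.eq_empty_or_nonempty with h0 | ⟨q, hq⟩
    · have : n = 1 := by simpa [hn] using h0
      simp [hA, this]
    · have hA0 := (hsmall q hq).2
      rw [← Finset.sum_filter, Finset.sum_const, nsmul_eq_mul]
      refine mul_le_mul_of_nonneg_right ?_ hA0
      have hsub : n.primeFactors.filter (fun p : ℕ => (p : ℝ) ≤ y) ⊆ Finset.Ioc 0 ⌊y⌋₊ := by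
        intro p hp
        rw [Finset.mem_filter] at hp
        exact Finset.mem_Ioc.2 ⟨(Nat.prime_of_mem_primeFactors hp.1).pos, Nat.le_floor hp.2⟩
      have := Finset.card_le_card hsub
      rw [Nat.card_Ioc, Nat.sub_zero] at this
      exact (Nat.cast_le.2 this).trans (Nat.floor_le (by linarith))
  rw [hF, Nat.cast_prod, log_prod fun p hp =>
    Nat.cast_ne_zero.2 (tauk_pos (by omega) (hpos p hp)).ne']
  refine (Finset.sum_le_sum hterm).trans ?_
  rw [Finset.sum_add_distrib, ← Finset.mul_sum]
  have hlog : ∑ p ∈ n.primeFactors, (n.factorization p * log p) = log n := by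
    rw [log_nat_eq_sum_factorization, Finsupp.sum, Nat.support_factorization]
  rw [hlog]
  have : log k / 2 / log y * log n = log k / 2 * log n / log y := by ring
  linarith

theorem tendsto_error_term (c : ℝ) {δ : ℝ} (hδ : 0 < δ) :
    Tendsto (fun x : ℝ => x ^ (1 - δ) * (logb 2 (x / log 2) * c) * log x / x) atTop (𝓝 0) := by
  have h1 := (isLittleO_log_rpow_rpow_atTop 1 hδ).tendsto_div_nhds_zero
  have h2 := (isLittleO_log_rpow_rpow_atTop 2 hδ).tendsto_div_nhds_zero
  have h := ((h2.const_mul (c / log 2)).sub (h1.const_mul (c * log (log 2) / log 2)))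
  simp only [mul_zero, sub_zero] at h
  refine h.congr' ?_
  filter_upwards [eventually_gt_atTop 0] with x hx
  have hl2 : log 2 ≠ 0 := (log_pos one_lt_two).ne'
  have hxδ : x ^ δ ≠ 0 := (rpow_pos_of_pos hx δ).ne'
  rw [logb, log_div hx.ne' hl2, rpow_sub hx, rpow_one, rpow_one, rpow_two]
  field_simp

theorem eventually_le_of_gt {k : ℕ} (hk : 2 ≤ k) {F : ℕ → ℕ} (hF1 : F 1 = 1)
    (hmul : ∀ m n : ℕ, Nat.Coprime m n → F (m * n) = F m * F n)
    (hFp : ∀ p a : ℕ, p.Prime → 1 ≤ a → F (p ^ a) = tauk k a)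
    {b : ℝ} (hb : log k / 2 < b) :
    ∀ᶠ n : ℕ in atTop, log (F n) * log (log n) / log n ≤ b := by
  have hlim : Tendsto (fun δ : ℝ => log k / 2 / (1 - δ)) (𝓝[>] 0) (𝓝 (log k / 2)) := by
    have : ContinuousAt (fun δ : ℝ => log k / 2 / (1 - δ)) 0 :=
      continuousAt_const.div (by fun_prop) (by norm_num)
    simpa using this.tendsto.mono_left nhdsWithin_le_nhds
  obtain ⟨δ, hδb, hδ0, hδ1⟩ := ((hlim.eventually_lt_const hb).and
    (Ioo_mem_nhdsGT (zero_lt_one (α := ℝ)))).exists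
  have hlogn : Tendsto (fun n : ℕ => log (n : ℝ)) atTop atTop :=
    tendsto_log_atTop.comp tendsto_natCast_atTop_atTop
  have herr := ((tendsto_error_term (log k) hδ0).comp hlogn).eventually_lt_const (sub_pos.2 hδb)
  filter_upwards [herr, hlogn.eventually_gt_atTop 1, eventually_ne_atTop 0] with n hn hL hn0
  simp only [Function.comp_apply] at hn
  set L := log (n : ℝ) with hLdef
  have hL0 : 0 < L := by linarith
  have hlL : 0 < log L := log_pos hL
  have hδ' : 0 < 1 - δ := by linarith
  have h := log_le_of_threshold hk hF1 hmul hFp hn0 (one_lt_rpow hL hδ')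
  rw [log_rpow hL0, ← hLdef, show logb 2 (n : ℝ) = L / log 2 from rfl] at h
  calc log (F n) * log L / L
      ≤ (L ^ (1 - δ) * (logb 2 (L / log 2) * log k) + log k / 2 * L / ((1 - δ) * log L))
          * log L / L := by gcongr
    _ = L ^ (1 - δ) * (logb 2 (L / log 2) * log k) * log L / L + log k / 2 / (1 - δ) := by
        rw [add_mul, add_div]
        congr 1
        field_simp
    _ ≤ b := by linarith

theorem eventually_half_le_theta : ∀ᶠ m : ℕ in atTop, (m : ℝ) / 2 ≤ Chebyshev.theta m := by
  have h1 : Tendsto (fun x : ℝ => 2 * (log x ^ (1 : ℝ) / x ^ (1 / 2 : ℝ))) atTop (𝓝 0) := by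
    simpa using ((isLittleO_log_rpow_rpow_atTop 1
      (half_pos one_pos : (0 : ℝ) < 1 / 2)).tendsto_div_nhds_zero).const_mul 2
  have h2 : Tendsto (fun x : ℝ => log (x + 1) / x) atTop (𝓝 0) := by
    have := (Real.isLittleO_log_id_atTop.comp_tendsto
      (tendsto_atTop_add_const_right atTop (1 : ℝ) tendsto_id))
    have h3 : (fun x : ℝ => x + 1) =O[atTop] (fun x : ℝ => x) :=
      (Asymptotics.isBigO_refl _ _).add
        (Asymptotics.isLittleO_const_id_atTop (1 : ℝ)).isBigO
    exact (this.trans_isBigO h3).tendsto_div_nhds_zero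
  have h := (h1.add h2).comp tendsto_natCast_atTop_atTop
  have hlog2 := Real.log_two_gt_d9
  rw [add_zero] at h
  filter_upwards [h.eventually_lt_const (show (0 : ℝ) < 0.1 by norm_num),
    eventually_gt_atTop 0] with m hm hm0
  have hm0' : (0 : ℝ) < m := by exact_mod_cast hm0
  refine le_trans ?_ (Chebyshev.theta_ge m)
  simp only [Function.comp_apply, rpow_one, ← sqrt_eq_rpow] at hm
  have hs : √(m : ℝ) * √m = m := mul_self_sqrt hm0'.le
  have hs0 : 0 < √(m : ℝ) := sqrt_pos.2 hm0'
  have key : 2 * (log m / √(m : ℝ)) + log (m + 1) / m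
      = (log (m + 1) + 2 * √m * log m) / m := by
    have : log m / √(m : ℝ) = √m * log m / m := by
      rw [div_eq_div_iff hs0.ne' hm0'.ne']
      linear_combination (-log m) * hs
    rw [this]; ring
  rw [key, div_lt_iff₀ hm0'] at hm
  nlinarith

theorem apply_prod_sq {F : ℕ → ℕ} (hF1 : F 1 = 1)
    (hmul : ∀ m n : ℕ, Nat.Coprime m n → F (m * n) = F m * F n)
    {c : ℕ} (hc : ∀ p : ℕ, p.Prime → F (p ^ 2) = c)
    (s : Finset ℕ) (hs : ∀ p ∈ s, p.Prime) : F (∏ p ∈ s, p ^ 2) = c ^ s.card := by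
  induction s using Finset.induction_on with
  | empty => simpa using hF1
  | insert q s hq ih =>
    have hs' : ∀ p ∈ s, p.Prime := fun p hp => hs p (Finset.mem_insert_of_mem hp)
    have hqp := hs q (Finset.mem_insert_self _ _)
    rw [Finset.prod_insert hq, hmul, hc q hqp, ih hs', Finset.card_insert_of_notMem hq, pow_succ']
    refine Nat.Coprime.prod_right fun p hp => Nat.Coprime.pow _ _ ?_
    exact (Nat.coprime_primes hqp (hs' p hp)).2 fun h => hq (h ▸ hp)

theorem frequently_ge {k : ℕ} (hk : 2 ≤ k) {F : ℕ → ℕ} (hF1 : F 1 = 1)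
    (hmul : ∀ m n : ℕ, Nat.Coprime m n → F (m * n) = F m * F n)
    (hFp : ∀ p a : ℕ, p.Prime → 1 ≤ a → F (p ^ a) = tauk k a) :
    ∃ᶠ n : ℕ in atTop, log k / 2 ≤ log (F n) * log (log n) / log n := by
  rw [frequently_atTop]
  intro N
  obtain ⟨m, hm, hmN, hm2⟩ := (eventually_half_le_theta.and
    ((eventually_ge_atTop N).and (eventually_ge_atTop 2))).exists
  have hprime : ∀ p ∈ Nat.primesLE m, p.Prime := fun p hp => (Nat.mem_primesLE.1 hp).2
  set n := ∏ p ∈ Nat.primesLE m, p ^ 2 with hn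
  have hlogn : log (n : ℝ) = 2 * Chebyshev.theta m := by
    rw [Chebyshev.theta_eq_sum_primesLE_log, hn, Nat.cast_prod, log_prod, Finset.mul_sum]
    · simp
    · exact fun p hp => Nat.cast_ne_zero.2 (pow_pos (hprime p hp).pos 2).ne'
  have hmL : (m : ℝ) ≤ log n := by linarith
  have hm0 : (0 : ℝ) < m := by positivity
  have hL0 : 0 < log (n : ℝ) := hm0.trans_le hmL
  refine ⟨n, hmN.trans ?_, ?_⟩
  · exact_mod_cast hmL.trans (log_le_self n.cast_nonneg)
  · have hF := apply_prod_sq hF1 hmul (fun p hp => hFp p 2 hp one_le_two) _ hprime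
    have hcard : (Nat.primesLE m).card = Nat.primeCounting m := by simp
    have hlogk : 0 ≤ log k := log_natCast_nonneg k
    have hkt : log k ≤ log (tauk k 2) :=
      log_le_log (by positivity) (by exact_mod_cast le_tauk k le_rfl)
    have hθ := Chebyshev.theta_le_pi_mul_log m
    have hlm : 0 ≤ log m := log_natCast_nonneg m
    rw [hF, hcard, Nat.cast_pow, Real.log_pow, le_div_iff₀ hL0]
    calc log k / 2 * log n = log k * Chebyshev.theta m := by rw [hlogn]; ring
      _ ≤ log k * (Nat.primeCounting m * log m) := by gcongr
      _ = Nat.primeCounting m * log k * log m := by ring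
      _ ≤ Nat.primeCounting m * log (tauk k 2) * log (log n) := by gcongr

/-- If `F = τ_k^{(e)}` is the multiplicative arithmetic function with
`F(p^a) = τ_k(a)` for every prime `p`, then
`limsup_{n → ∞} (log F(n) · log log n) / log n = (log k)/2` for `k ≥ 2`. -/
theorem max_order_tauke (k : ℕ) (hk : 2 ≤ k) (F : ℕ → ℕ) (hF1 : F 1 = 1)
    (hmul : ∀ m n : ℕ, Nat.Coprime m n → F (m * n) = F m * F n)
    (hFp : ∀ p a : ℕ, p.Prime → 1 ≤ a → F (p ^ a) = tauk k a) :
    Filter.limsup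
      (fun n : ℕ => Real.log (F n) * Real.log (Real.log n) / Real.log n)
      Filter.atTop = Real.log k / 2 := by
  have hub := fun b (hb : Real.log k / 2 < b) => eventually_le_of_gt hk hF1 hmul hFp hb
  have hfreq := frequently_ge hk hF1 hmul hFp
  have hbdd : IsBoundedUnder (· ≤ ·) atTop
      (fun n : ℕ => Real.log (F n) * Real.log (Real.log n) / Real.log n) :=
    isBoundedUnder_of_eventually_le (hub _ (lt_add_one _))
  refine le_antisymm (le_of_forall_gt_imp_ge_of_dense fun b hb => ?_) ?_
  · exact limsup_le_of_le (IsCoboundedUnder.of_frequently_ge hfreq) (hub b hb)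
  · exact le_limsup_of_frequently_le hfreq hbdd
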